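/- arXiv:1208.1509 — 3 statements merged into one kernel-verified Lean document; each statement's English description precedes it below -/
import Mathlib

section
/- Let μ, ν ∈ 𝓜 with μ ≤C ν, and suppose μ = μ̃ + δ where δ = α·δ_x is a point mass of weight α > 0 at the point x ∈ ℝ. Then there exists a unique pair of measures (ν', ν̃) with ν' + ν̃ = ν such that: (1) δ ≤C ν', i.e. ν'(ℝ) = α and ∫ y dν'(y) = α·x; and (2) ν̃(I) = 0, where I is the interior of the smallest interval containing the support of ν'. Moreover, for this pair one has μ̃ ≤C ν̃. -/
open MeasureTheory Set Filter Topology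

noncomputable section

/-- Convex order of finite measures on `ℝ` with finite first moments. -/
def ConvexOrder (μ ν : MeasureTheory.Measure ℝ) : Prop :=
  μ Set.univ = ν Set.univ ∧
  (∫ x, x ∂μ) = (∫ x, x ∂ν) ∧
  ∀ k : ℝ, (∫ x, max (x - k) 0 ∂μ) ≤ ∫ x, max (x - k) 0 ∂ν

/-- Extended convex order: integrals of nonnegative convex functions increase. -/
def ExtConvexOrder (μ ν : MeasureTheory.Measure ℝ) : Prop :=
  ∀ φ : ℝ → ℝ, ConvexOn ℝ Set.univ φ → (∀ x, 0 ≤ φ x) →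
    (∫⁻ x, ENNReal.ofReal (φ x) ∂μ) ≤ ∫⁻ x, ENNReal.ofReal (φ x) ∂ν

/-- `π` is a transport plan with marginals `μ` and `ν`. -/
def IsCoupling (μ ν : MeasureTheory.Measure ℝ) (π : MeasureTheory.Measure (ℝ × ℝ)) : Prop :=
  π.map Prod.fst = μ ∧ π.map Prod.snd = ν

/-- `π ∈ Π_M(μ,ν)`: a coupling satisfying the martingale condition. -/
def IsMartingaleCoupling (μ ν : MeasureTheory.Measure ℝ) (π : MeasureTheory.Measure (ℝ × ℝ)) : Prop :=
  IsCoupling μ ν π ∧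
  ∀ ρ : ℝ → ℝ, Continuous ρ → (∃ M : ℝ, ∀ x, |ρ x| ≤ M) →
    (∫ p : ℝ × ℝ, ρ p.1 * (p.2 - p.1) ∂π) = 0

/-- `S` is the shadow `S^ν(μ)` of `μ` in `ν`. -/
def IsShadow (μ ν S : MeasureTheory.Measure ℝ) : Prop :=
  S ≤ ν ∧ ConvexOrder μ S ∧
  ∀ η : MeasureTheory.Measure ℝ, η ≤ ν → ConvexOrder μ η → ConvexOrder S η

/-- `π` is the left-curtain coupling between `μ` and `ν`. -/
def IsLeftCurtain (μ ν : MeasureTheory.Measure ℝ) (π : MeasureTheory.Measure (ℝ × ℝ)) : Prop :=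
  IsMartingaleCoupling μ ν π ∧
  ∀ x : ℝ, IsShadow (μ.restrict (Set.Iic x)) ν
    (MeasureTheory.Measure.map Prod.snd (π.restrict ((Set.Iic x) ×ˢ (Set.univ : Set ℝ))))

/-- `π` is left-monotone. -/
def IsLeftMonotone (π : MeasureTheory.Measure (ℝ × ℝ)) : Prop :=
  ∃ Γ : Set (ℝ × ℝ), MeasurableSet Γ ∧ π Γᶜ = 0 ∧
    ∀ x x' ym yp y' : ℝ, (x, ym) ∈ Γ → (x, yp) ∈ Γ → (x', y') ∈ Γ →
      x < x' → ym < y' → y' < yp → False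

/-- The sufficient integrability condition on the cost function. -/
def SuffInt (c : ℝ → ℝ → ℝ) (μ ν : MeasureTheory.Measure ℝ) : Prop :=
  ∃ a b : ℝ → ℝ, MeasureTheory.Integrable a μ ∧ MeasureTheory.Integrable b ν ∧
    ∀ x y : ℝ, a x + b y ≤ c x y

/-- `π` is an optimal martingale transport plan (with finite cost) for the cost `c`. -/
def IsOptimalMart (c : ℝ → ℝ → ℝ) (μ ν : MeasureTheory.Measure ℝ)
    (π : MeasureTheory.Measure (ℝ × ℝ)) : Prop :=
  IsMartingaleCoupling μ ν π ∧
  MeasureTheory.Integrable (fun p : ℝ × ℝ => c p.1 p.2) π ∧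
  ∀ π' : MeasureTheory.Measure (ℝ × ℝ), IsMartingaleCoupling μ ν π' →
    MeasureTheory.Integrable (fun p : ℝ × ℝ => c p.1 p.2) π' →
    (∫ p : ℝ × ℝ, c p.1 p.2 ∂π) ≤ ∫ p : ℝ × ℝ, c p.1 p.2 ∂π'

/-- The (topological) support of a Borel measure on `ℝ`: points all of whose open
neighbourhoods have positive measure. -/
def measSupport (m : MeasureTheory.Measure ℝ) : Set ℝ :=
  {x : ℝ | ∀ U : Set ℝ, IsOpen U → x ∈ U → m U ≠ 0}

lemma int_call {m : Measure ℝ} [IsFiniteMeasure m] (h : Integrable (fun x : ℝ => x) m) (k : ℝ) :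
    Integrable (fun y : ℝ => max (y - k) 0) m :=
  (h.sub (integrable_const k)).sup (integrable_const 0)

lemma measSupport_eq (m : Measure ℝ) : measSupport m = m.support := by
  rw [Measure.support_eq_forall_isOpen]
  ext x
  simp only [measSupport, mem_ofPred_eq, pos_iff_ne_zero]
  exact ⟨fun h U a b => h U b a, fun h U a b => h U b a⟩

lemma ae_hull (m : Measure ℝ) : ∀ᵐ y ∂m, y ∈ convexHull ℝ (measSupport m) := by
  have : m.support ∈ ae m := Measure.support_mem_ae
  filter_upwards [this] with y hy
  exact subset_convexHull _ _ (by rwa [measSupport_eq])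

lemma hull_side {H : Set ℝ} (hH : Convex ℝ H) {k : ℝ} (hk : k ∉ interior H) :
    (∀ y ∈ H, y ≤ k) ∨ (∀ y ∈ H, k ≤ y) := by
  by_contra hcon
  push Not at hcon
  obtain ⟨⟨v, hv, hkv⟩, u, hu, huk⟩ := hcon
  apply hk
  rw [mem_interior]
  exact ⟨Ioo u v, Ioo_subset_Icc_self.trans (hH.ordConnected.out hu hv), isOpen_Ioo, huk, hkv⟩

lemma dirac_call (α : ℝ) (hα : 0 < α) (x k : ℝ) :
    ∫ y, max (y - k) 0 ∂(ENNReal.ofReal α • Measure.dirac x) = α * max (x - k) 0 := by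
  rw [integral_smul_measure, integral_dirac, ENNReal.toReal_ofReal hα.le, smul_eq_mul]

lemma dirac_id (α : ℝ) (hα : 0 < α) (x : ℝ) :
    ∫ y, y ∂(ENNReal.ofReal α • Measure.dirac x) = α * x := by
  rw [integral_smul_measure, integral_dirac, ENNReal.toReal_ofReal hα.le, smul_eq_mul]

lemma dirac_mass {α : ℝ} (hα : 0 < α) {x : ℝ} {m : Measure ℝ}
    (h : ConvexOrder (ENNReal.ofReal α • Measure.dirac x) m) : m.real univ = α := by
  have := h.1
  rw [Measure.real, ← this]
  simp [hα.le]

lemma call_outside {α : ℝ} (hα : 0 < α) {x : ℝ} {m : Measure ℝ} [IsFiniteMeasure m]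
    (hm : Integrable (fun x : ℝ => x) m)
    (h : ConvexOrder (ENNReal.ofReal α • Measure.dirac x) m) {k : ℝ}
    (hk : k ∉ interior (convexHull ℝ (measSupport m))) :
    ∫ y, max (y - k) 0 ∂m ≤ α * max (x - k) 0 := by
  rcases hull_side (convex_convexHull ℝ _) hk with hs | hs
  · have : ∫ y, max (y - k) 0 ∂m = 0 := by
      apply integral_eq_zero_of_ae
      filter_upwards [ae_hull m] with y hy
      simpa using hs y hy
    rw [this]
    positivity
  · have : ∫ y, max (y - k) 0 ∂m = ∫ y, (y - k) ∂m := by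
      apply integral_congr_ae
      filter_upwards [ae_hull m] with y hy
      simpa using hs y hy
    rw [this, integral_sub hm (integrable_const k), ← h.2.1, dirac_id α hα, integral_const,
      dirac_mass hα h, smul_eq_mul, ← mul_sub]
    gcongr
    exact le_max_left _ _

lemma domin {I : Set ℝ} (hI : IsOpen I) (hc : I.OrdConnected) {k : ℝ} (hk : k ∈ I) :
    I = univ ∨ ∃ p q r c d : ℝ, 0 ≤ p ∧ 0 ≤ q ∧ c ∉ I ∧ d ∉ I ∧
      (∀ y, max (y - k) 0 ≤ p * max (y - c) 0 + q * max (y - d) 0 + r) ∧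
      ∀ y ∉ I, max (y - k) 0 = p * max (y - c) 0 + q * max (y - d) 0 + r := by
  have hne : I.Nonempty := ⟨k, hk⟩
  have hlow : BddBelow I → sInf I ∉ I := by
    intro hb h
    obtain ⟨e, he, hs⟩ := Metric.isOpen_iff.1 hI _ h
    have : sInf I - e / 2 ∈ I := hs (by simp [abs_of_pos he]; linarith)
    linarith [csInf_le hb this]
  have hup : BddAbove I → sSup I ∉ I := by
    intro hb h
    obtain ⟨e, he, hs⟩ := Metric.isOpen_iff.1 hI _ h
    have : sSup I + e / 2 ∈ I := hs (by simp [abs_of_pos he]; linarith)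
    linarith [le_csSup hb this]
  by_cases hb : BddBelow I <;> by_cases ha : BddAbove I
  · right
    have h1 := hlow hb
    have h2 := hup ha
    have hak : sInf I < k := lt_of_le_of_ne (csInf_le hb hk) (fun h => h1 (h ▸ hk))
    have hbk : k < sSup I := lt_of_le_of_ne (le_csSup ha hk) (fun h => h2 (h ▸ hk))
    have hout : ∀ y ∉ I, y ≤ sInf I ∨ sSup I ≤ y := by
      intro y hy
      by_contra hcon
      push Not at hcon
      obtain ⟨u, hu, huy⟩ := exists_lt_of_csInf_lt hne hcon.1
      obtain ⟨v, hv, hvy⟩ := exists_lt_of_lt_csSup hne hcon.2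
      exact hy (hc.out hu hv ⟨huy.le, hvy.le⟩)
    generalize sInf I = a at *
    generalize sSup I = b at *
    have hab : 0 < b - a := by linarith
    have hp : 0 ≤ (b - k) / (b - a) := div_nonneg (by linarith) hab.le
    have hq : 0 ≤ (k - a) / (b - a) := div_nonneg (by linarith) hab.le
    have hpq : (b - k) / (b - a) + (k - a) / (b - a) = 1 := by field_simp; ring
    have hpk : (b - k) / (b - a) * a + (k - a) / (b - a) * b = k := by field_simp; ring
    refine ⟨(b - k) / (b - a), (k - a) / (b - a), 0, a, b, hp, hq, h1, h2, ?_, ?_⟩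
    · generalize (b - k) / (b - a) = p at *
      generalize (k - a) / (b - a) = q at *
      intro y
      apply max_le
      · have e1 := mul_le_mul_of_nonneg_left (le_max_left (y - a) 0) hp
        have e2 := mul_le_mul_of_nonneg_left (le_max_left (y - b) 0) hq
        have : y - k = p * (y - a) + q * (y - b) := by
          linear_combination hpk - y * hpq
        linarith
      · positivity
    · generalize (b - k) / (b - a) = p at *
      generalize (k - a) / (b - a) = q at *
      intro y hy
      rcases hout y hy with h | h
      · rw [max_eq_right (by linarith), max_eq_right (by linarith), max_eq_right (by linarith)]
        ring
      · rw [max_eq_left (by linarith), max_eq_left (by linarith), max_eq_left (by linarith)]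
        linear_combination hpk - y * hpq
  · right
    have h1 := hlow hb
    have hak : sInf I < k := lt_of_le_of_ne (csInf_le hb hk) (fun h => h1 (h ▸ hk))
    refine ⟨1, 0, 0, sInf I, sInf I, by simp, by simp, h1, h1, ?_, ?_⟩
    · intro y
      simp only [one_mul, zero_mul, add_zero]
      gcongr
    · intro y hy
      have : y ≤ sInf I := by
        by_contra hcon
        push Not at hcon
        obtain ⟨u, hu, huy⟩ := exists_lt_of_csInf_lt hne hcon
        obtain ⟨v, hv, hvy⟩ := not_bddAbove_iff.1 ha y
        exact hy (hc.out hu hv ⟨huy.le, hvy.le⟩)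
      rw [max_eq_right (by linarith), max_eq_right (by linarith)]
      ring
  · right
    have h2 := hup ha
    have hbk : k < sSup I := lt_of_le_of_ne (le_csSup ha hk) (fun h => h2 (h ▸ hk))
    refine ⟨1, 0, sSup I - k, sSup I, sSup I, by simp, by simp, h2, h2, ?_, ?_⟩
    · intro y
      have e1 := le_max_left (y - sSup I) 0
      have e2 := le_max_right (y - sSup I) 0
      apply max_le <;> linarith
    · intro y hy
      have : sSup I ≤ y := by
        by_contra hcon
        push Not at hcon
        obtain ⟨v, hv, hvy⟩ := exists_lt_of_lt_csSup hne hcon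
        obtain ⟨u, hu, huy⟩ := not_bddBelow_iff.1 hb y
        exact hy (hc.out hu hv ⟨huy.le, hvy.le⟩)
      rw [max_eq_left (by linarith), max_eq_left (by linarith)]
      ring
  · left
    ext y
    obtain ⟨v, hv, hvy⟩ := not_bddAbove_iff.1 ha y
    obtain ⟨u, hu, huy⟩ := not_bddBelow_iff.1 hb y
    simpa using hc.out hu hv ⟨huy.le, hvy.le⟩

lemma int_comb {m : Measure ℝ} [IsFiniteMeasure m] (h : Integrable (fun x : ℝ => x) m)
    (p q r c d : ℝ) :
    Integrable (fun y => p * max (y - c) 0 + q * max (y - d) 0 + r) m ∧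
    ∫ y, (p * max (y - c) 0 + q * max (y - d) 0 + r) ∂m =
      p * ∫ y, max (y - c) 0 ∂m + q * ∫ y, max (y - d) 0 ∂m + m.real univ * r := by
  have e1 := (int_call h c).const_mul p
  have e2 := (int_call h d).const_mul q
  have e12 : Integrable (fun y => p * max (y - c) 0 + q * max (y - d) 0) m := e1.add e2
  refine ⟨e12.add (integrable_const r), ?_⟩
  rw [integral_add e12 (integrable_const r), integral_add e1 e2, integral_const_mul,
    integral_const_mul, integral_const, smul_eq_mul]

lemma hull_oc (m : Measure ℝ) :
    (interior (convexHull ℝ (measSupport m))).OrdConnected :=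
  (convex_convexHull ℝ _).interior.ordConnected

/-- minimality -/
lemma shadow_min {α : ℝ} (hα : 0 < α) {x : ℝ} {ν m mt η ηt : Measure ℝ} [IsFiniteMeasure ν]
    [IsFiniteMeasure m] [IsFiniteMeasure mt] [IsFiniteMeasure η] [IsFiniteMeasure ηt]
    (hν : Integrable (fun x : ℝ => x) ν)
    (hm : m + mt = ν) (hη : η + ηt = ν)
    (h : ConvexOrder (ENNReal.ofReal α • Measure.dirac x) m)
    (h' : ConvexOrder (ENNReal.ofReal α • Measure.dirac x) η)
    (h0 : mt (interior (convexHull ℝ (measSupport m))) = 0) (k : ℝ) :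
    ∫ y, max (y - k) 0 ∂m ≤ ∫ y, max (y - k) 0 ∂η := by
  have im : Integrable (fun x : ℝ => x) m := hν.mono_measure (hm ▸ Measure.le_add_right le_rfl)
  have imt : Integrable (fun x : ℝ => x) mt := hν.mono_measure (hm ▸ Measure.le_add_left le_rfl)
  have iη : Integrable (fun x : ℝ => x) η := hν.mono_measure (hη ▸ Measure.le_add_right le_rfl)
  have iηt : Integrable (fun x : ℝ => x) ηt := hν.mono_measure (hη ▸ Measure.le_add_left le_rfl)
  have out : ∀ c ∉ interior (convexHull ℝ (measSupport m)),
      ∫ y, max (y - c) 0 ∂m ≤ ∫ y, max (y - c) 0 ∂η := fun c hc =>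
    (call_outside hα im h hc).trans ((dirac_call α hα x c).symm.le.trans (h'.2.2 c))
  by_cases hk : k ∈ interior (convexHull ℝ (measSupport m))
  · rcases domin isOpen_interior (hull_oc m) hk with hu | ⟨p, q, r, c, d, hp, hq, hc, hd, h1, h2⟩
    · rw [hu, Measure.measure_univ_eq_zero] at h0
      have e : η univ + ηt univ = η univ := by
        rw [← Measure.add_apply, hη, ← hm, h0, add_zero, ← h.1, h'.1]
      have e2 : ηt univ = 0 := by
        have := ENNReal.add_right_inj (measure_ne_top η univ) (b := ηt univ) (c := 0)
        rw [add_zero] at this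
        exact this.1 e
      rw [Measure.measure_univ_eq_zero] at e2
      have : m = η := by rw [h0, add_zero] at hm; rw [e2, add_zero] at hη; rw [hm, hη]
      rw [this]
    · have key : ∀ (ρ : Measure ℝ) [IsFiniteMeasure ρ], Integrable (fun x : ℝ => x) ρ →
          Integrable (fun y => (p * max (y - c) 0 + q * max (y - d) 0 + r) - max (y - k) 0) ρ ∧
          ∫ y, ((p * max (y - c) 0 + q * max (y - d) 0 + r) - max (y - k) 0) ∂ρ =
          p * ∫ y, max (y - c) 0 ∂ρ + q * ∫ y, max (y - d) 0 ∂ρ + ρ.real univ * r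
            - ∫ y, max (y - k) 0 ∂ρ := by
        intro ρ _ hρ
        obtain ⟨a1, a2⟩ := int_comb hρ p q r c d
        exact ⟨a1.sub (int_call hρ k), by rw [integral_sub a1 (int_call hρ k), a2]⟩
      set g : ℝ → ℝ := fun y => (p * max (y - c) 0 + q * max (y - d) 0 + r) - max (y - k) 0
      have gnn : ∀ y, 0 ≤ g y := fun y => sub_nonneg.2 (h1 y)
      have z : ∫ y, g y ∂mt = 0 := by
        apply integral_eq_zero_of_ae
        have : ∀ᵐ y ∂mt, y ∉ interior (convexHull ℝ (measSupport m)) :=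
          measure_eq_zero_iff_ae_notMem.1 h0
        filter_upwards [this] with y hy
        simp [g, h2 y hy]
      have z1 : ∫ y, g y ∂m = ∫ y, g y ∂ν := by
        rw [← hm, integral_add_measure (key m im).1 (key mt imt).1, z, add_zero]
      have z2 : ∫ y, g y ∂η ≤ ∫ y, g y ∂ν := by
        rw [← hη, integral_add_measure (key η iη).1 (key ηt iηt).1]
        have := integral_nonneg (μ := ηt) (f := g) gnn
        linarith
      rw [(key m im).2] at z1
      rw [(key η iη).2] at z2
      rw [dirac_mass hα h] at z1
      rw [dirac_mass hα h'] at z2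
      have w1 := mul_le_mul_of_nonneg_left (out c hc) hp
      have w2 := mul_le_mul_of_nonneg_left (out d hd) hq
      linarith
  · exact out k hk

lemma ext_call {m η : Measure ℝ} [IsFiniteMeasure m] [IsFiniteMeasure η]
    (im : Integrable (fun x : ℝ => x) m) (iη : Integrable (fun x : ℝ => x) η)
    (hu : m univ = η univ)
    (h : ∀ k, ∫ y, max (y - k) 0 ∂m = ∫ y, max (y - k) 0 ∂η) : m = η := by
  have lim : ∀ (ρ : Measure ℝ) [IsFiniteMeasure ρ], Integrable (fun x : ℝ => x) ρ → ∀ k : ℝ,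
      Tendsto (fun n : ℕ => (n + 1 : ℝ) * (∫ y, max (y - k) 0 ∂ρ -
        ∫ y, max (y - (k + 1 / (n + 1 : ℝ))) 0 ∂ρ)) atTop (𝓝 (ρ.real (Ioi k))) := by
    intro ρ _ hρ k
    have e : ∀ n : ℕ, (n + 1 : ℝ) * (∫ y, max (y - k) 0 ∂ρ -
        ∫ y, max (y - (k + 1 / (n + 1 : ℝ))) 0 ∂ρ) =
        ∫ y, (n + 1 : ℝ) * (max (y - k) 0 - max (y - (k + 1 / (n + 1 : ℝ))) 0) ∂ρ := by
      intro n
      rw [integral_const_mul, integral_sub (int_call hρ _) (int_call hρ _)]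
    simp_rw [e]
    rw [← integral_indicator_one measurableSet_Ioi]
    apply tendsto_integral_of_dominated_convergence (fun _ => (1 : ℝ))
    · intro n
      exact (((int_call hρ _).sub (int_call hρ _)).const_mul _).aestronglyMeasurable
    · exact integrable_const _
    · intro n
      refine ae_of_all _ fun y => ?_
      have hn : (0 : ℝ) < n + 1 := by positivity
      have hn' : (0 : ℝ) < 1 / (n + 1) := by positivity
      have a1 : 0 ≤ max (y - k) 0 - max (y - (k + 1 / (n + 1 : ℝ))) 0 :=
        sub_nonneg.2 (max_le_max_right _ (by linarith))
      have a2 : max (y - k) 0 - max (y - (k + 1 / (n + 1 : ℝ))) 0 ≤ 1 / (n + 1 : ℝ) := by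
        have := le_max_left (y - (k + 1 / (n + 1 : ℝ))) 0
        have := le_max_right (y - (k + 1 / (n + 1 : ℝ))) 0
        have : max (y - k) 0 ≤ max (y - (k + 1 / (n + 1 : ℝ))) 0 + 1 / (n + 1 : ℝ) :=
          max_le (by linarith) (by linarith)
        linarith
      rw [Real.norm_of_nonneg (by positivity)]
      calc _ ≤ (n + 1 : ℝ) * (1 / (n + 1 : ℝ)) := by gcongr
        _ = 1 := by field_simp
    · refine ae_of_all _ fun y => ?_
      by_cases hy : k < y
      · have : (indicator (Ioi k) (1 : ℝ → ℝ)) y = 1 := by simp [hy]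
        rw [this]
        apply tendsto_const_nhds.congr'
        have hl : ∀ᶠ n : ℕ in atTop, 1 / ((n : ℝ) + 1) < y - k :=
          tendsto_one_div_add_atTop_nhds_zero_nat.eventually_lt_const (by linarith)
        filter_upwards [hl] with n hn
        have hn0 : (0 : ℝ) < n + 1 := by positivity
        rw [max_eq_left (by linarith), max_eq_left (by linarith)]
        field_simp
        ring
      · have : (indicator (Ioi k) (1 : ℝ → ℝ)) y = 0 := by simp [hy]
        rw [this]
        apply tendsto_const_nhds.congr
        intro n
        have hn' : (0 : ℝ) < 1 / (n + 1) := by positivity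
        rw [max_eq_right (by linarith), max_eq_right (by linarith)]
        simp
  refine Measure.ext_of_Iic _ _ fun k => ?_
  have e : m.real (Ioi k) = η.real (Ioi k) := by
    refine tendsto_nhds_unique (lim m im k) ?_
    simp_rw [h]
    exact lim η iη k
  have e' : m (Ioi k) = η (Ioi k) := (measureReal_eq_measureReal_iff).1 e
  have c : Iic k = (Ioi k)ᶜ := by simp
  rw [c, measure_compl measurableSet_Ioi (measure_ne_top _ _),
    measure_compl measurableSet_Ioi (measure_ne_top _ _), e', hu]

lemma rest_order {α : ℝ} (hα : 0 < α) {x : ℝ} {μt ν m mt : Measure ℝ} [IsFiniteMeasure ν]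
    [IsFiniteMeasure μt]
    [IsFiniteMeasure m] [IsFiniteMeasure mt]
    (hμt : Integrable (fun x : ℝ => x) μt)
    (hν : Integrable (fun x : ℝ => x) ν)
    (hord : ConvexOrder (μt + ENNReal.ofReal α • Measure.dirac x) ν)
    (hm : m + mt = ν)
    (h : ConvexOrder (ENNReal.ofReal α • Measure.dirac x) m)
    (h0 : mt (interior (convexHull ℝ (measSupport m))) = 0) : ConvexOrder μt mt := by
  have im : Integrable (fun x : ℝ => x) m := hν.mono_measure (hm ▸ Measure.le_add_right le_rfl)
  have imt : Integrable (fun x : ℝ => x) mt := hν.mono_measure (hm ▸ Measure.le_add_left le_rfl)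
  have iδ : Integrable (fun x : ℝ => x) (ENNReal.ofReal α • Measure.dirac x) :=
    (integrable_dirac (by simp)).smul_measure (by simp)
  have : IsFiniteMeasure (ENNReal.ofReal α • Measure.dirac x) :=
    Measure.smul_finite _ (by simp)
  obtain ⟨o1, o2, o3⟩ := hord
  have mass : μt univ = mt univ := by
    rw [← hm, Measure.add_apply, Measure.add_apply, h.1, add_comm] at o1
    exact (ENNReal.add_right_inj (measure_ne_top m univ)).1 o1
  refine ⟨mass, ?_, ?_⟩
  · rw [← hm, integral_add_measure hμt iδ, integral_add_measure im imt, h.2.1] at o2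
    linarith
  have out : ∀ c ∉ interior (convexHull ℝ (measSupport m)),
      ∫ y, max (y - c) 0 ∂μt ≤ ∫ y, max (y - c) 0 ∂mt := by
    intro c hc
    have := call_outside hα im h hc
    have o := o3 c
    rw [← hm, integral_add_measure (int_call hμt c) (int_call iδ c),
      integral_add_measure (int_call im c) (int_call imt c), dirac_call α hα] at o
    linarith
  intro k
  by_cases hk : k ∈ interior (convexHull ℝ (measSupport m))
  · rcases domin isOpen_interior (hull_oc m) hk with hu | ⟨p, q, r, c, d, hp, hq, hc, hd, h1, h2⟩
    · rw [hu] at h0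
      rw [h0, Measure.measure_univ_eq_zero] at mass
      rw [Measure.measure_univ_eq_zero] at h0
      simp [mass, h0]
    · have w1 := mul_le_mul_of_nonneg_left (out c hc) hp
      have w2 := mul_le_mul_of_nonneg_left (out d hd) hq
      have z : ∫ y, max (y - k) 0 ∂mt =
          ∫ y, (p * max (y - c) 0 + q * max (y - d) 0 + r) ∂mt := by
        apply integral_congr_ae
        have : ∀ᵐ y ∂mt, y ∉ interior (convexHull ℝ (measSupport m)) :=
          measure_eq_zero_iff_ae_notMem.1 h0
        filter_upwards [this] with y hy
        exact h2 y hy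
      have z2 := integral_mono (int_call hμt k) (int_comb hμt p q r c d).1 h1
      rw [z, (int_comb imt p q r c d).2]
      rw [(int_comb hμt p q r c d).2] at z2
      have : μt.real univ = mt.real univ := by rw [Measure.real, mass]; rfl
      rw [this] at z2
      linarith
  · exact out k hk

lemma exists_quantile (ν : Measure ℝ) [IsFiniteMeasure ν] (hpos : 0 < ν.real univ) :
    ∃ G : ℝ → ℝ, MonotoneOn G (Ioo 0 (ν.real univ)) ∧
      (volume.restrict (Ioo 0 (ν.real univ))).map G = ν := by
  set m := ν.real univ with hm
  have : NeZero ν := ⟨by rintro rfl; simp [hm] at hpos⟩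
  have hF : ∀ y, m * ProbabilityTheory.cdf ((ν univ)⁻¹ • ν) y = ν.real (Iic y) := by
    intro y
    rw [ProbabilityTheory.cdf_eq_real, measureReal_ennreal_smul_apply, ENNReal.toReal_inv, hm,
      ← measureReal_def, ← mul_assoc, mul_inv_cancel₀ hpos.ne', one_mul]
  set F : ℝ → ℝ := fun y => ν.real (Iic y) with hFdef
  have hFe : F = fun y => m * ProbabilityTheory.cdf ((ν univ)⁻¹ • ν) y := by
    ext y; rw [hF]
  have hbot : Tendsto F atBot (𝓝 0) := by
    rw [hFe]
    simpa using (ProbabilityTheory.tendsto_cdf_atBot ((ν univ)⁻¹ • ν)).const_mul m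
  have htop : Tendsto F atTop (𝓝 m) := by
    rw [hFe]
    simpa using (ProbabilityTheory.tendsto_cdf_atTop ((ν univ)⁻¹ • ν)).const_mul m
  have hrc : ∀ y, Tendsto F (𝓝[>] y) (𝓝 (F y)) := by
    intro y
    rw [hFe]
    exact (((ProbabilityTheory.cdf ((ν univ)⁻¹ • ν)).right_continuous y).mono_left
      (nhdsWithin_mono _ Ioi_subset_Ici_self)).const_mul m
  have hmono : Monotone F := fun a b hab => measureReal_mono (Iic_subset_Iic.2 hab)
  have hle : ∀ y, F y ≤ m := fun y => measureReal_mono (subset_univ _)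
  set G : ℝ → ℝ := fun t => sInf {y | t ≤ F y} with hG
  have hbb : ∀ t, 0 < t → BddBelow {y | t ≤ F y} := by
    intro t ht
    obtain ⟨u, hu⟩ := (hbot.eventually_lt_const ht).exists
    refine ⟨u, fun y (hy : t ≤ F y) => ?_⟩
    by_contra hcon
    push Not at hcon
    linarith [hmono hcon.le]
  have hne : ∀ t, t < m → {y | t ≤ F y}.Nonempty := by
    intro t ht
    obtain ⟨u, hu⟩ := (htop.eventually_const_lt ht).exists
    exact ⟨u, hu.le⟩
  have hgal : ∀ t ∈ Ioo 0 m, ∀ y, G t ≤ y ↔ t ≤ F y := by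
    intro t ht y
    refine ⟨fun h => ?_, fun h => csInf_le (hbb t ht.1) h⟩
    refine le_trans ?_ (hmono h)
    refine ge_of_tendsto (hrc (G t)) ?_
    filter_upwards [self_mem_nhdsWithin] with z hz
    obtain ⟨u, hu, huz⟩ := exists_lt_of_csInf_lt (hne t ht.2) hz
    exact le_trans hu (hmono huz.le)
  have hGm : MonotoneOn G (Ioo 0 m) := by
    intro a ha b hb hab
    rw [hgal a ha]
    exact hab.trans ((hgal b hb _).1 le_rfl)
  refine ⟨G, hGm, ?_⟩
  have hae : AEMeasurable G (volume.restrict (Ioo 0 m)) :=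
    aemeasurable_restrict_of_monotoneOn measurableSet_Ioo hGm
  refine Measure.ext_of_Iic _ _ fun y => ?_
  rw [Measure.map_apply_of_aemeasurable hae measurableSet_Iic, 
    Measure.restrict_apply' measurableSet_Ioo]
  have e : G ⁻¹' Iic y ∩ Ioo 0 m = Iic (F y) ∩ Ioo 0 m := by
    ext t
    simp only [mem_inter_iff, mem_preimage, mem_Iic, and_congr_left_iff]
    exact fun ht => hgal t ht y
  rw [e]
  have hup : volume (Iic (F y) ∩ Ioo 0 m) ≤ ENNReal.ofReal (F y) := by
    calc _ ≤ volume (Ioc 0 (F y)) := measure_mono (fun t ht => And.intro ht.2.1 ht.1)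
      _ = _ := by simp
  have hlo : ENNReal.ofReal (F y) ≤ volume (Iic (F y) ∩ Ioo 0 m) := by
    calc ENNReal.ofReal (F y) = volume (Ioo 0 (F y)) := by simp
      _ ≤ _ := measure_mono (fun t ht => And.intro ht.2.le (And.intro ht.1 (ht.2.trans_le (hle y))))
  rw [le_antisymm hup hlo]
  simp [F]

/-- pieces of the quantile parametrisation -/
def qp (G : ℝ → ℝ) (a b : ℝ) : Measure ℝ := (volume.restrict (Ioo a b)).map G

lemma qp_split {G : ℝ → ℝ} {m : ℝ} (hG : MonotoneOn G (Ioo 0 m)) {a b c : ℝ} (h0 : 0 ≤ a)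
    (hab : a ≤ b) (hbc : b ≤ c) (hc : c ≤ m) : qp G a b + qp G b c = qp G a c := by
  have hme : ∀ u v, 0 ≤ u → v ≤ m → AEMeasurable G (volume.restrict (Ioo u v)) := fun u v hu hv =>
    aemeasurable_restrict_of_monotoneOn measurableSet_Ioo (hG.mono (Ioo_subset_Ioo hu hv))
  ext s hs
  rw [Measure.add_apply, qp, qp, qp, 
    Measure.map_apply_of_aemeasurable (hme a b h0 (hbc.trans hc)) hs,
    Measure.map_apply_of_aemeasurable (hme b c (h0.trans hab) hc) hs,
    Measure.map_apply_of_aemeasurable (hme a c h0 hc) hs, ← Measure.add_apply]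
  congr 1
  rw [restrict_Ioo_eq_restrict_Ioc, restrict_Ioo_eq_restrict_Ioc, restrict_Ioo_eq_restrict_Ioc,
    ← Measure.restrict_union _ measurableSet_Ioc, Ioc_union_Ioc_eq_Ioc hab hbc]
  exact Set.disjoint_left.2 fun t h1 h2 => absurd h1.2 (not_le.2 h2.1)

lemma qp_univ {G : ℝ → ℝ} {m : ℝ} (hG : MonotoneOn G (Ioo 0 m)) {a b : ℝ} (h0 : 0 ≤ a)
    (hb : b ≤ m) : qp G a b univ = ENNReal.ofReal (b - a) := by
  have hme : AEMeasurable G (volume.restrict (Ioo a b)) :=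
    aemeasurable_restrict_of_monotoneOn measurableSet_Ioo (hG.mono (Ioo_subset_Ioo h0 hb))
  rw [qp, Measure.map_apply_of_aemeasurable hme MeasurableSet.univ]
  simp

lemma qp_ae {G : ℝ → ℝ} {m : ℝ} (hG : MonotoneOn G (Ioo 0 m)) {a b : ℝ} (h0 : 0 ≤ a)
    (hb : b ≤ m) {S : Set ℝ} (hS : MeasurableSet S) (h : ∀ t ∈ Ioo a b, G t ∈ S) :
    ∀ᵐ y ∂(qp G a b), y ∈ S := by
  have hme : AEMeasurable G (volume.restrict (Ioo a b)) :=
    aemeasurable_restrict_of_monotoneOn measurableSet_Ioo (hG.mono (Ioo_subset_Ioo h0 hb))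
  rw [qp, ae_map_iff (p := fun y => y ∈ S) hme hS]
  exact ae_restrict_of_forall_mem measurableSet_Ioo h

lemma qp_hull {G : ℝ → ℝ} {m : ℝ} (hG : MonotoneOn G (Ioo 0 m)) {a b : ℝ} (h0 : 0 ≤ a)
    (hb : b ≤ m) {S : Set ℝ} (hS : IsClosed S) (hc : Convex ℝ S) (h : ∀ t ∈ Ioo a b, G t ∈ S) :
    interior (convexHull ℝ (measSupport (qp G a b))) ⊆ interior S := by
  apply interior_mono
  apply convexHull_min _ hc
  rw [measSupport_eq]
  exact Measure.support_subset_of_isClosed hS (qp_ae hG h0 hb hS.measurableSet h)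

lemma jensen {α : ℝ} (hα : 0 < α) {x : ℝ} {m : Measure ℝ} [IsFiniteMeasure m]
    (hm : Integrable (fun x : ℝ => x) m) (h1 : m univ = ENNReal.ofReal α)
    (h2 : ∫ y, y ∂m = α * x) : ConvexOrder (ENNReal.ofReal α • Measure.dirac x) m := by
  refine ⟨by simp [h1], by rw [dirac_id α hα, h2], fun k => ?_⟩
  rw [dirac_call α hα, mul_max_of_nonneg _ _ hα.le, mul_zero]
  apply max_le
  · have e : ∫ y, (y - k) ∂m = α * (x - k) := by
      rw [integral_sub hm (integrable_const k), integral_const, h2, Measure.real, h1,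
        ENNReal.toReal_ofReal hα.le, smul_eq_mul]
      ring
    rw [← e]
    exact integral_mono (hm.sub (integrable_const k)) (int_call hm k) fun y => le_max_left _ _
  · exact integral_nonneg fun y => le_max_right _ _

lemma exists_split {α : ℝ} (hα : 0 < α) {x : ℝ} {μt ν : Measure ℝ} [IsFiniteMeasure ν]
    [IsFiniteMeasure μt]
    (hμt : Integrable (fun x : ℝ => x) μt)
    (hν : Integrable (fun x : ℝ => x) ν)
    (hord : ConvexOrder (μt + ENNReal.ofReal α • Measure.dirac x) ν) :
    ∃ m mt : Measure ℝ, m + mt = ν ∧ ConvexOrder (ENNReal.ofReal α • Measure.dirac x) m ∧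
      mt (interior (convexHull ℝ (measSupport m))) = 0 := by
  have iδ : Integrable (fun x : ℝ => x) (ENNReal.ofReal α • Measure.dirac x) :=
    (integrable_dirac (by simp)).smul_measure (by simp)
  have : IsFiniteMeasure (ENNReal.ofReal α • Measure.dirac x) :=
    Measure.smul_finite _ (by simp)
  obtain ⟨o1, o2, o3⟩ := id hord
  have hmass : μt.real univ + α = ν.real univ := by
    rw [Measure.real, Measure.real, ← o1, Measure.add_apply, ENNReal.toReal_add
      (measure_ne_top _ _) (measure_ne_top _ _)]
    simp [hα.le]
  rw [integral_add_measure hμt iδ, dirac_id α hα] at o2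
  have hnn : 0 ≤ μt.real univ := measureReal_nonneg
  rcases hnn.eq_or_lt with hz | hlt
  · refine ⟨ν, 0, by simp, ?_, by simp⟩
    have : μt = 0 := by
      rw [← Measure.measure_univ_eq_zero]
      exact (measureReal_eq_zero_iff).1 hz.symm
    rwa [this, zero_add] at hord
  set m := ν.real univ with hm
  obtain ⟨G, hG, hGν⟩ := exists_quantile ν (by linarith)
  rw [← hm] at hG hGν
  have hν0 : qp G 0 m = ν := hGν
  have hae : ∀ a b, 0 ≤ a → b ≤ m → AEMeasurable G (volume.restrict (Ioo a b)) :=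
    fun a b h0 hb =>
    aemeasurable_restrict_of_monotoneOn measurableSet_Ioo (hG.mono (Ioo_subset_Ioo h0 hb))
  have hfin : ∀ a b, IsFiniteMeasure (qp G a b) := fun a b => by
    unfold qp; infer_instance
  have hqle : ∀ a b, 0 ≤ a → a ≤ b → b ≤ m → qp G a b ≤ ν := by
    intro a b h0 hab hb
    rw [← hν0, ← qp_split hG le_rfl (h0.trans hab) hb le_rfl, ← qp_split hG le_rfl h0 hab hb]
    exact (Measure.le_add_left le_rfl).trans (Measure.le_add_right le_rfl)
  have hqi : ∀ a b, 0 ≤ a → a ≤ b → b ≤ m → Integrable (fun x : ℝ => x) (qp G a b) :=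
    fun a b h0 hab hb => hν.mono_measure (hqle a b h0 hab hb)
  have hqr : ∀ a b, 0 ≤ a → a ≤ b → b ≤ m → (qp G a b).real univ = b - a := by
    intro a b h0 hab hb
    rw [Measure.real, qp_univ hG h0 hb, ENNReal.toReal_ofReal (by linarith)]
  -- the mean as an interval integral
  have hGint : IntegrableOn G (Ioo 0 m) := by
    have := hν
    rw [← hν0, qp, integrable_map_measure (g := fun x : ℝ => x) measurable_id.aestronglyMeasurable
      (hae 0 m le_rfl le_rfl)] at this
    exact this
  have hprim : ∀ a b, 0 ≤ a → a ≤ b → b ≤ m →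
      ∫ y, y ∂(qp G a b) = ∫ t in a..b, G t := by
    intro a b h0 hab hb
    rw [qp, integral_map (f := fun x : ℝ => x) (hae a b h0 hb) measurable_id.aestronglyMeasurable,
      intervalIntegral.integral_of_le hab, integral_Ioc_eq_integral_Ioo]
  have hJc : ContinuousOn (fun b => ∫ y, y ∂(qp G 0 b)) (Icc 0 m) := by
    have hc : ContinuousOn (fun b => ∫ t in (0 : ℝ)..b, G t) (Icc 0 m) := by
      have := intervalIntegral.continuousOn_primitive_interval (f := G) (μ := volume)
        (a := 0) (b := m) (by
          rw [uIcc_of_le (by linarith), integrableOn_Icc_iff_integrableOn_Ioo]; exact hGint)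
      rwa [uIcc_of_le (by linarith)] at this
    exact hc.congr fun b hb => hprim 0 b le_rfl hb.1 hb.2
  have hadd : ∀ a b c, 0 ≤ a → a ≤ b → b ≤ c → c ≤ m → ∀ f : ℝ → ℝ, Integrable f ν →
      ∫ y, f y ∂(qp G a c) = ∫ y, f y ∂(qp G a b) + ∫ y, f y ∂(qp G b c) := by
    intro a b c h0 hab hbc hc f hf
    rw [← qp_split hG h0 hab hbc hc, integral_add_measure
      (hf.mono_measure (hqle a b h0 hab (hbc.trans hc)))
      (hf.mono_measure (hqle b c (h0.trans hab) hbc hc))]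
  have hcut : ∀ r ∈ Ioo 0 m, ∫ y, max (y - G r) 0 ∂ν =
      ∫ y, y ∂(qp G r m) - (m - r) * G r := by
    intro r hr
    have := hadd 0 r m le_rfl hr.1.le hr.2.le le_rfl _ (int_call hν (G r))
    rw [hν0] at this
    rw [this]
    have z1 : ∫ y, max (y - G r) 0 ∂(qp G 0 r) = 0 := by
      apply integral_eq_zero_of_ae
      filter_upwards [qp_ae hG le_rfl hr.2.le (S := Iic (G r)) measurableSet_Iic
        (fun t ht => hG ⟨ht.1, ht.2.trans hr.2⟩ hr ht.2.le)] with y hy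
      simpa using hy
    have z2 : ∫ y, max (y - G r) 0 ∂(qp G r m) = ∫ y, (y - G r) ∂(qp G r m) := by
      apply integral_congr_ae
      filter_upwards [qp_ae hG hr.1.le le_rfl (S := Ici (G r)) measurableSet_Ici
        (fun t ht => hG hr ⟨hr.1.trans ht.1, ht.2⟩ ht.1.le)] with y hy
      simpa using hy
    rw [z1, z2, integral_sub (hqi r m hr.1.le hr.2.le le_rfl) (integrable_const _),
      integral_const, hqr r m hr.1.le hr.2.le le_rfl, smul_eq_mul, zero_add]
  have hcall : ∀ c, α * max (x - c) 0 + ∫ y, max (y - c) 0 ∂μt ≤ ∫ y, max (y - c) 0 ∂ν := by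
    intro c
    have o := o3 c
    rw [integral_add_measure (int_call hμt c) (int_call iδ c), dirac_call α hα] at o
    linarith
  have hJ : ∀ s ∈ Icc 0 (m - α), ∫ y, y ∂(qp G s (s + α)) =
      ∫ y, y ∂(qp G 0 (s + α)) - ∫ y, y ∂(qp G 0 s) := by
    intro s hs
    have := hadd 0 s (s + α) le_rfl hs.1 (by linarith) (by linarith [hs.2]) _ hν
    linarith
  have hcont : ContinuousOn (fun s => ∫ y, y ∂(qp G s (s + α))) (Icc 0 (m - α)) := by
    refine ContinuousOn.congr ?_ hJ
    refine ContinuousOn.sub ?_ (hJc.mono (Icc_subset_Icc le_rfl (by linarith)))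
    refine hJc.comp (f := fun s => s + α) (by fun_prop) ?_
    intro s hs
    exact ⟨by linarith [hs.1], by linarith [hs.2]⟩
  have hl : ∫ y, y ∂(qp G 0 (0 + α)) ≤ α * x := by
    rw [zero_add]
    have e1 := hcut α ⟨hα, by linarith⟩
    have e2 := hcall (G α)
    have e3 : ∫ y, (y - G α) ∂μt ≤ ∫ y, max (y - G α) 0 ∂μt :=
      integral_mono (hμt.sub (integrable_const _)) (int_call hμt _) fun y => le_max_left _ _
    rw [integral_sub hμt (integrable_const _), integral_const, smul_eq_mul] at e3
    have e4 : 0 ≤ α * max (x - G α) 0 := by positivity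
    have e5 := hadd 0 α m le_rfl hα.le (by linarith) le_rfl _ hν
    rw [hν0] at e5
    have e6 : μt.real univ = m - α := by linarith
    rw [e6] at e3
    linarith
  have hr : α * x ≤ ∫ y, y ∂(qp G (m - α) (m - α + α)) := by
    rw [sub_add_cancel]
    have e1 := hcut (m - α) ⟨by linarith, by linarith⟩
    have e2 := hcall (G (m - α))
    have e3 : 0 ≤ ∫ y, max (y - G (m - α)) 0 ∂μt := integral_nonneg fun y => le_max_right _ _
    have e4 : α * (x - G (m - α)) ≤ α * max (x - G (m - α)) 0 := by
      gcongr; exact le_max_left _ _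
    have e5 : (m - (m - α)) * G (m - α) = α * G (m - α) := by ring
    rw [e5] at e1
    linarith
  obtain ⟨s, hs, hsx⟩ := intermediate_value_Icc (by linarith) hcont ⟨hl, hr⟩
  have hs1 := hs.1
  have hs2 : s + α ≤ m := by linarith [hs.2]
  refine ⟨qp G s (s + α), qp G 0 s + qp G (s + α) m, ?_, ?_, ?_⟩
  · rw [← hν0, ← qp_split hG le_rfl (by linarith) hs2 le_rfl,
      ← qp_split hG le_rfl hs1 (by linarith : s ≤ s + α) hs2]
    abel
  · refine jensen hα (hqi s _ hs1 (by linarith) hs2) ?_ hsx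
    rw [qp_univ hG hs1 hs2]
    simp
  · have hI := (isOpen_interior (s := convexHull ℝ (measSupport (qp G s (s + α))))).measurableSet
    rw [Measure.add_apply, add_eq_zero, measure_eq_zero_iff_ae_notMem,
      measure_eq_zero_iff_ae_notMem]
    constructor
    · refine qp_ae hG le_rfl (by linarith) hI.compl fun t ht hmem => ?_
      have := qp_hull hG hs1 hs2 (isClosed_Ici (a := G t)) (convex_Ici _)
        (fun u hu => hG ⟨ht.1, by linarith [ht.2]⟩ ⟨by linarith [hu.1], by linarith [hu.2]⟩
          (by linarith [hu.1, ht.2])) hmem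
      simp at this
    · refine qp_ae hG (by linarith) le_rfl hI.compl fun t ht hmem => ?_
      have := qp_hull hG hs1 hs2 (isClosed_Iic (a := G t)) (convex_Iic _)
        (fun u hu => hG ⟨by linarith [hu.1], by linarith [hu.2]⟩ ⟨by linarith [ht.1], ht.2⟩
          (by linarith [hu.2, ht.1])) hmem
      simp at this

/-- splitting off the shadow of an atom. -/
theorem atom_shadow_splitting
    (μt ν : MeasureTheory.Measure ℝ)
    [MeasureTheory.IsFiniteMeasure μt] [MeasureTheory.IsFiniteMeasure ν]
    (hμt : MeasureTheory.Integrable (fun x : ℝ => x) μt)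
    (hν : MeasureTheory.Integrable (fun x : ℝ => x) ν)
    (α : ℝ) (hα : 0 < α) (x : ℝ)
    (hord : ConvexOrder (μt + ENNReal.ofReal α • MeasureTheory.Measure.dirac x) ν) :
    (∃! p : MeasureTheory.Measure ℝ × MeasureTheory.Measure ℝ,
      p.1 + p.2 = ν ∧
      ConvexOrder (ENNReal.ofReal α • MeasureTheory.Measure.dirac x) p.1 ∧
      p.2 (interior (convexHull ℝ (measSupport p.1))) = 0) ∧
    ∀ ν' νt : MeasureTheory.Measure ℝ, ν' + νt = ν →
      ConvexOrder (ENNReal.ofReal α • MeasureTheory.Measure.dirac x) ν' →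
      νt (interior (convexHull ℝ (measSupport ν'))) = 0 →
      ConvexOrder μt νt := by
  have fin : ∀ a b : Measure ℝ, a + b = ν → IsFiniteMeasure a ∧ IsFiniteMeasure b := by
    intro a b h
    exact ⟨isFiniteMeasure_of_le ν (h ▸ Measure.le_add_right le_rfl),
      isFiniteMeasure_of_le ν (h ▸ Measure.le_add_left le_rfl)⟩
  refine ⟨?_, ?_⟩
  · obtain ⟨m, mt, h1, h2, h3⟩ := exists_split hα hμt hν hord
    refine ⟨(m, mt), ⟨h1, h2, h3⟩, ?_⟩
    rintro ⟨η, ηt⟩ ⟨g1, g2, g3⟩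
    simp only at g1 g2 g3
    obtain ⟨_, _⟩ := fin _ _ h1
    obtain ⟨_, _⟩ := fin _ _ g1
    have e : η = m := by
      refine ext_call (hν.mono_measure (g1 ▸ Measure.le_add_right le_rfl))
        (hν.mono_measure (h1 ▸ Measure.le_add_right le_rfl)) (g2.1.symm.trans h2.1) fun k => ?_
      exact le_antisymm (shadow_min hα hν g1 h1 g2 h2 g3 k) (shadow_min hα hν h1 g1 h2 g2 h3 k)
    subst e
    have e2 : ηt = mt := by
      ext s hs
      have : (η + ηt) s = (η + mt) s := by rw [g1, h1]
      rw [Measure.add_apply, Measure.add_apply] at this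
      exact (ENNReal.add_right_inj (measure_ne_top η s)).1 this
    rw [e2]
  · intro m mt h1 h2 h3
    obtain ⟨_, _⟩ := fin _ _ h1
    exact rest_order hα hμt hν hord h1 h2 h3
end
end

section
/- Let γ ∈ 𝓜. Then there exists a sequence (γₙ) of finitely supported measures in 𝓜 such that γₙ ≤C γₙ₊₁ and γₙ ≤C γ for every n, and (γₙ) converges weakly in 𝓜 to γ, i.e. ∫ f dγₙ → ∫ f dγ for every continuous function f : ℝ → ℝ of at most linear growth (|f(x)| ≤ a|x| + b for some constants a, b ≥ 0). -/
open MeasureTheory Set Filter Topology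

noncomputable section

theorem aux_finite_range (n : ℕ) (f : ℝ → ℝ)
    (hf : Measurable[ProbabilityTheory.countableFiltration ℝ n] f) : (range f).Finite := by
  have hfin : {s : Set ℝ | MeasurableSet[ProbabilityTheory.countableFiltration ℝ n] s}.Finite := by
    refine ((MeasurableSpace.finite_countablePartition ℝ n).finite_subsets.image
      (fun S => Set.sUnion S)).subset ?_
    intro s hs
    obtain ⟨S, hS, rfl⟩ :=
      (MeasurableSpace.measurableSet_generateFrom_countablePartition_iff n s).1 hs
    exact ⟨↑S, hS, rfl⟩
  refine Set.Finite.of_finite_image (f := fun y => f ⁻¹' {y}) (hfin.subset ?_) ?_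
  · rintro _ ⟨y, -, rfl⟩
    exact hf (measurableSet_singleton y)
  · rintro _ ⟨x, rfl⟩ z _ h
    have : x ∈ f ⁻¹' {z} := by
      have h' : f ⁻¹' {f x} = f ⁻¹' {z} := h
      rw [← h']; simp
    simpa using this

theorem aux_order (γ : Measure ℝ) [IsFiniteMeasure γ] 
    (F : Filtration ℕ Real.measurableSpace) (n : ℕ) (Y Z : ℝ → ℝ) (hY : Integrable Y γ)
    (hYm : Measurable Y) (hZm : Measurable Z) (hZ : Z =ᵐ[γ] γ[Y | F n]) :
    ConvexOrder (γ.map Z) (γ.map Y) := by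
  have hm := F.le n
  refine ⟨?_, ?_, fun k => ?_⟩
  · simp [Measure.map_apply hZm, Measure.map_apply hYm]
  · rw [integral_map hZm.aemeasurable (by fun_prop), integral_map hYm.aemeasurable (by fun_prop),
      integral_congr_ae hZ, integral_condExp hm]
  · rw [integral_map hZm.aemeasurable (by fun_prop), integral_map hYm.aemeasurable (by fun_prop),
      ← integral_condExp hm (f := fun x => max (Y x - k) 0)]
    have hk : Integrable (fun _ : ℝ => k) γ := integrable_const k
    have hYk : Integrable (fun x => Y x - k) γ := hY.sub hk
    have hP : Integrable (fun x => max (Y x - k) 0) γ := hYk.pos_part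
    have hZi : Integrable Z γ := integrable_condExp.congr hZ.symm
    refine integral_mono_ae (hZi.sub hk).pos_part integrable_condExp ?_
    have h1 := condExp_mono (m := F n) hYk hP (.of_forall fun x => le_max_left _ _)
    have h2 : 0 ≤ᵐ[γ] γ[fun x => max (Y x - k) 0 | F n] :=
      condExp_nonneg (.of_forall fun x => le_max_right _ _)
    have h3 := condExp_sub hY hk (F n)
    rw [condExp_const hm] at h3
    filter_upwards [h1, h2, h3, hZ] with x h1 h2 h3 h4
    refine max_le ?_ h2
    rw [h4]
    exact h3.symm.le.trans h1

theorem aux_conv (γ : Measure ℝ) [IsFiniteMeasure γ] (hγ : Integrable (fun x : ℝ => x) γ)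
    (X : ℕ → ℝ → ℝ) (hXm : ∀ n, Measurable (X n)) (hXi : ∀ n, Integrable (X n) γ)
    (hae : ∀ᵐ x ∂γ, Tendsto (fun n => X n x) atTop (𝓝 x))
    (hL : Tendsto (fun n => ∫ x, |X n x - x| ∂γ) atTop (𝓝 0))
    (f : ℝ → ℝ) (hf : Continuous f) (a b : ℝ) (ha : 0 ≤ a)
    (hfb : ∀ x, |f x| ≤ a * |x| + b) :
    Tendsto (fun n => ∫ x, f (X n x) ∂γ) atTop (𝓝 (∫ x, f x ∂γ)) := by
  have hfX : ∀ Y : ℝ → ℝ, Measurable Y → Integrable Y γ → Integrable (fun x => f (Y x)) γ := by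
    intro Y hYm hY
    refine Integrable.mono' ((hY.abs.const_mul a).add (integrable_const b))
      (hf.measurable.comp hYm).aestronglyMeasurable (.of_forall fun x => ?_)
    exact hfb (Y x)
  have hfi : Integrable f γ := hfX _ measurable_id hγ
  have hD : ∀ n, Integrable (fun x => |X n x - x|) γ := fun n => ((hXi n).sub hγ).abs
  have hbd : Integrable (fun x : ℝ => 2 * a * |x| + 2 * b) γ :=
    (hγ.abs.const_mul (2 * a)).add (integrable_const _)
  have hE : ∀ n, Integrable (fun x => |f (X n x) - f x|) γ :=
    fun n => ((hfX _ (hXm n) (hXi n)).sub hfi).abs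
  have hH : ∀ n, Integrable (fun x => max (|f (X n x) - f x| - a * |X n x - x|) 0) γ :=
    fun n => ((hE n).sub ((hD n).const_mul a)).pos_part
  have h0 : Tendsto (fun n => ∫ x, max (|f (X n x) - f x| - a * |X n x - x|) 0 ∂γ) atTop
      (𝓝 (∫ x, (0 : ℝ) ∂γ)) := by
    refine tendsto_integral_of_dominated_convergence (fun x : ℝ => 2 * a * |x| + 2 * b)
      (fun n => (hH n).aestronglyMeasurable) hbd (fun n => .of_forall fun x => ?_) ?_
    · have hb : 0 ≤ b := by simpa using (abs_nonneg _).trans (hfb 0)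
      rw [Real.norm_of_nonneg (le_max_right _ _)]
      refine max_le ?_ (by positivity)
      have e1 := abs_sub (f (X n x)) (f x)
      have e2 := hfb (X n x)
      have e3 := hfb x
      have e4 : |X n x| ≤ |X n x - x| + |x| := by
        simpa using abs_add_le (X n x - x) x
      have e5 := mul_le_mul_of_nonneg_left e4 ha
      linarith
    · filter_upwards [hae] with x hx
      have c : Continuous fun y => max (|f y - f x| - a * |y - x|) 0 := by fun_prop
      have c2 := (c.tendsto x).comp hx
      simp only [sub_self, abs_zero, mul_zero, max_self] at c2
      exact c2
  rw [tendsto_iff_norm_sub_tendsto_zero]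
  refine squeeze_zero (fun n => norm_nonneg _) (g := fun n =>
    (∫ x, max (|f (X n x) - f x| - a * |X n x - x|) 0 ∂γ) + a * ∫ x, |X n x - x| ∂γ)
    (fun n => ?_) ?_
  · rw [← integral_sub (hfX _ (hXm n) (hXi n)) hfi, ← integral_const_mul,
      ← integral_add (hH n) ((hD n).const_mul a)]
    refine (norm_integral_le_integral_norm _).trans ?_
    refine integral_mono (hE n) ((hH n).add ((hD n).const_mul a)) fun x => ?_
    have := le_max_left (|f (X n x) - f x| - a * |X n x - x|) 0
    simp only [Real.norm_eq_abs, Pi.add_apply]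
    linarith
  · simpa using h0.add (hL.const_mul a)

/-- approximation of a measure from below in the convex order by
finitely supported measures, with weak convergence in `𝓜`. -/
theorem approx_in_convexOrder
    (γ : MeasureTheory.Measure ℝ) [MeasureTheory.IsFiniteMeasure γ]
    (hγ : MeasureTheory.Integrable (fun x : ℝ => x) γ) :
    ∃ γs : ℕ → MeasureTheory.Measure ℝ,
      (∀ n, MeasureTheory.IsFiniteMeasure (γs n) ∧
        MeasureTheory.Integrable (fun x : ℝ => x) (γs n) ∧
        ∃ s : Finset ℝ, γs n ((↑s : Set ℝ)ᶜ) = 0) ∧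
      (∀ n, ConvexOrder (γs n) (γs (n + 1))) ∧
      (∀ n, ConvexOrder (γs n) γ) ∧
      ∀ f : ℝ → ℝ, Continuous f →
        (∃ a b : ℝ, 0 ≤ a ∧ 0 ≤ b ∧ ∀ x : ℝ, |f x| ≤ a * |x| + b) →
        Filter.Tendsto (fun n => ∫ x, f x ∂(γs n)) Filter.atTop
          (nhds (∫ x, f x ∂γ)) := by
  set F := ProbabilityTheory.countableFiltration ℝ with hF
  set X : ℕ → ℝ → ℝ := fun n => γ[(fun x : ℝ => x) | F n] with hX
  have hXF : ∀ n, Measurable[F n] (X n) := fun n => stronglyMeasurable_condExp.measurable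
  have hXm : ∀ n, Measurable (X n) := fun n => (hXF n).mono (F.le n) le_rfl
  have hXi : ∀ n, Integrable (X n) γ := fun n => integrable_condExp
  have hsm : StronglyMeasurable[⨆ n, F n] (fun x : ℝ => x) := by
    rw [hF, ProbabilityTheory.iSup_countableFiltration]
    exact stronglyMeasurable_id
  have hae := hγ.tendsto_ae_condExp hsm
  have hL := hγ.tendsto_eLpNorm_condExp hsm
  refine ⟨fun n => γ.map (X n), fun n => ⟨inferInstance, ?_, ?_⟩, fun n => ?_, fun n => ?_, ?_⟩
  · rw [integrable_map_measure (by fun_prop) (hXm n).aemeasurable]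
    exact hXi n
  · refine ⟨(aux_finite_range n (X n) (hXF n)).toFinset, ?_⟩
    rw [Measure.map_apply (hXm n) (Finset.measurableSet _).compl]
    convert measure_empty (μ := γ)
    ext x
    simp
  · exact aux_order γ F n _ _ (hXi (n + 1)) (hXm _) (hXm _)
      (condExp_condExp_of_le (F.mono n.le_succ) (F.le _)).symm
  · have := aux_order γ F n (fun x => x) (X n) hγ measurable_id (hXm n) ae_eq_rfl
    rwa [Measure.map_id'] at this
  · rintro f hf ⟨a, b, ha, -, hfb⟩
    have e : ∀ n, ∫ x, f x ∂(γ.map (X n)) = ∫ x, f (X n x) ∂γ := fun n =>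
      integral_map (hXm n).aemeasurable hf.aestronglyMeasurable
    simp only [e]
    refine aux_conv γ hγ X hXm hXi hae ?_ f hf a b ha hfb
    have := (ENNReal.tendsto_toReal ENNReal.zero_ne_top).comp hL
    refine this.congr fun n => ?_
    simp only [Function.comp]
    rw [eLpNorm_one_eq_lintegral_enorm, ← integral_norm_eq_lintegral_enorm
      ((hXi n).sub hγ).aestronglyMeasurable]
    rfl
end
end

section
/- Let k be a positive integer and Γ ⊆ ℝ×ℝ, and for a ∈ ℝ write Γ_a = {y ∈ ℝ : (a,y) ∈ Γ}. Assume the set {a ∈ ℝ : |Γ_a| ≥ k} is uncountable. Then there exist a ∈ ℝ and b₁ < b₂ < ⋯ < b_k, all in Γ_a, such that for every ε > 0: (1) there exist a' > a and b₁' < ⋯ < b_k' in Γ_{a'} with max(|a−a'|, |b₁−b₁'|, …, |b_k−b_k'|) < ε; and (2) there exist a'' < a and b₁'' < ⋯ < b_k'' in Γ_{a''} with max(|a−a''|, |b₁−b₁''|, …, |b_k−b_k''|) < ε. -/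
open MeasureTheory Set Filter Topology

noncomputable section

/-- accumulation lemma for fibers of a planar set. -/
theorem accumulation_of_fibers
    (k : ℕ) (hk : 0 < k) (Γ : Set (ℝ × ℝ))
    (h : ¬ ({a : ℝ | (k : ℕ∞) ≤ ({y : ℝ | (a, y) ∈ Γ}).encard}).Countable) :
    ∃ (a : ℝ) (b : Fin k → ℝ), StrictMono b ∧ (∀ i, (a, b i) ∈ Γ) ∧
      ∀ ε : ℝ, 0 < ε →
        (∃ (a' : ℝ) (b' : Fin k → ℝ), a < a' ∧ StrictMono b' ∧
          (∀ i, (a', b' i) ∈ Γ) ∧ |a - a'| < ε ∧ ∀ i, |b i - b' i| < ε) ∧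
        (∃ (a'' : ℝ) (b'' : Fin k → ℝ), a'' < a ∧ StrictMono b'' ∧
          (∀ i, (a'', b'' i) ∈ Γ) ∧ |a - a''| < ε ∧ ∀ i, |b i - b'' i| < ε) := by
  classical
  have hB : ∀ a : ℝ, (k : ℕ∞) ≤ ({y : ℝ | (a, y) ∈ Γ}).encard →
      ∃ b : Fin k → ℝ, StrictMono b ∧ ∀ i, (a, b i) ∈ Γ := by
    intro a ha
    obtain ⟨t, hts, htk⟩ := Set.exists_subset_encard_eq ha
    have hfin : t.Finite := Set.finite_of_encard_eq_coe htk
    have hcard : hfin.toFinset.card = k := by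
      rw [hfin.encard_eq_coe_toFinset_card] at htk
      exact_mod_cast htk
    refine ⟨hfin.toFinset.orderEmbOfFin hcard, (hfin.toFinset.orderEmbOfFin hcard).strictMono, ?_⟩
    intro i
    have := Finset.orderEmbOfFin_mem hfin.toFinset hcard i
    exact hts (hfin.mem_toFinset.mp this)
  choose! B hBm hBΓ using hB
  set A : Set ℝ := {a : ℝ | (k : ℕ∞) ≤ ({y : ℝ | (a, y) ∈ Γ}).encard} with hA
  let S : Set (Fin k → ℝ) → Set ℝ := fun U => {a | a ∈ A ∧ B a ∈ U}
  let 𝓑 := TopologicalSpace.countableBasis (Fin k → ℝ)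
  have h𝓑 : 𝓑.Countable := TopologicalSpace.countable_countableBasis _
  have hbad : (⋃ U ∈ 𝓑, ({x ∈ S U | 𝓝[S U ∩ Ioi x] x = ⊥} ∪
      {x ∈ S U | 𝓝[S U ∩ Iio x] x = ⊥})).Countable :=
    h𝓑.biUnion fun U _ => (countable_setOfPred_isolated_right_within).union
      (countable_setOfPred_isolated_left_within)
  obtain ⟨a, haA, hab⟩ : ∃ a ∈ A, a ∉ (⋃ U ∈ 𝓑, ({x ∈ S U | 𝓝[S U ∩ Ioi x] x = ⊥} ∪
      {x ∈ S U | 𝓝[S U ∩ Iio x] x = ⊥})) := by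
    by_contra! hc
    exact h (hbad.mono hc)
  refine ⟨a, B a, hBm a haA, hBΓ a haA, fun ε hε => ?_⟩
  obtain ⟨U, hU, haU, hUε⟩ := (TopologicalSpace.isBasis_countableBasis
    (Fin k → ℝ)).exists_subset_of_mem_open (Metric.mem_ball_self hε : B a ∈ Metric.ball (B a) ε)
    Metric.isOpen_ball
  have haS : a ∈ S U := ⟨haA, haU⟩
  have hclose : ∀ x ∈ S U, ∀ i, |B a i - B x i| < ε := by
    intro x hx i
    have h1 := hUε hx.2
    rw [Metric.mem_ball, dist_comm] at h1
    exact lt_of_le_of_lt (dist_le_pi_dist (B a) (B x) i) h1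
  have hnear : ∀ T : Set ℝ, 𝓝[T] a ≠ ⊥ → ∃ x ∈ T, |a - x| < ε := by
    intro T hT
    have : (𝓝[T] a).NeBot := ⟨hT⟩
    have h1 : ∀ᶠ x in 𝓝[T] a, x ∈ T ∧ x ∈ Metric.ball a ε :=
      (eventually_mem_nhdsWithin).and
        (mem_nhdsWithin_of_mem_nhds (Metric.ball_mem_nhds a hε))
    obtain ⟨x, hx, hx'⟩ := h1.exists
    refine ⟨x, hx, ?_⟩
    rw [Metric.mem_ball, dist_comm] at hx'
    exact hx'
  constructor
  · obtain ⟨x, ⟨hxS, hxa⟩, hx⟩ := hnear (S U ∩ Ioi a) fun hbot =>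
      hab (mem_biUnion hU (Or.inl ⟨haS, hbot⟩))
    exact ⟨x, B x, hxa, hBm x hxS.1, hBΓ x hxS.1, hx, hclose x hxS⟩
  · obtain ⟨x, ⟨hxS, hxa⟩, hx⟩ := hnear (S U ∩ Iio a) fun hbot =>
      hab (mem_biUnion hU (Or.inr ⟨haS, hbot⟩))
    exact ⟨x, B x, hxa, hBm x hxS.1, hBΓ x hxS.1, hx, hclose x hxS⟩
end
end
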